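/- Let n ≥ 2, x₀ ∈ ℝ^n and r > 0, and let B_r(x₀) = {x ∈ ℝ^n : ‖x−x₀‖ < r} be the open ball. Then the function x ↦ (n−1)/‖x−x₀‖ − ⟨x, x−x₀⟩/‖x−x₀‖ is γ_n-integrable on B_r(x₀), and P_γ(B_r(x₀)) = ∫_{B_r(x₀)} [ (n−1)/‖x−x₀‖ − ⟨x, x−x₀⟩/‖x−x₀‖ ] dγ_n(x). In particular every ball in ℝ^n has finite Gaussian perimeter. -/

import Mathlib

open MeasureTheory Real Filter
open scoped RealInnerProductSpace ENNReal

/-- The standard Gaussian measure `γ_n` on `ℝ^n`, with density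
`(2π)^{-n/2} exp(-‖x‖²/2)` with respect to Lebesgue measure. -/
noncomputable def gaussianMeasure (n : ℕ) : Measure (EuclideanSpace ℝ (Fin n)) :=
  (volume : Measure (EuclideanSpace ℝ (Fin n))).withDensity fun x =>
    ENNReal.ofReal ((2 * π) ^ (-(n : ℝ) / 2) * Real.exp (-‖x‖ ^ 2 / 2))

/-- The Gaussian divergence `div_γ φ(x) = div φ(x) − ⟨x, φ(x)⟩` of a vector field. -/
noncomputable def gdiv (n : ℕ) (φ : EuclideanSpace ℝ (Fin n) → EuclideanSpace ℝ (Fin n))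
    (x : EuclideanSpace ℝ (Fin n)) : ℝ :=
  (∑ i : Fin n, fderiv ℝ φ x (EuclideanSpace.single i 1) i) - ⟪x, φ x⟫

/-- A vector field is admissible if it is `C¹`, bounded with bounded derivative,
and satisfies `‖φ(x)‖ ≤ 1` for all `x`. -/
def Admissible (n : ℕ) (φ : EuclideanSpace ℝ (Fin n) → EuclideanSpace ℝ (Fin n)) : Prop :=
  ContDiff ℝ 1 φ ∧ (∃ M, ∀ x, ‖fderiv ℝ φ x‖ ≤ M) ∧ ∀ x, ‖φ x‖ ≤ 1

/-- The Gaussian total variation `V_γ(u) = sup {∫ u · div_γ φ dγ_n : φ admissible}`. -/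
noncomputable def totVar (n : ℕ) (u : EuclideanSpace ℝ (Fin n) → ℝ) : ℝ≥0∞ :=
  ⨆ (φ : EuclideanSpace ℝ (Fin n) → EuclideanSpace ℝ (Fin n)) (_ : Admissible n φ),
    ENNReal.ofReal (∫ x, u x * gdiv n φ x ∂(gaussianMeasure n))

/-- The Gaussian perimeter `P_γ(E) = V_γ(χ_E)` of a set `E ⊆ ℝⁿ`. -/
noncomputable def gPerimeter (n : ℕ) (E : Set (EuclideanSpace ℝ (Fin n))) : ℝ≥0∞ :=
  totVar n (E.indicator fun _ => 1)


/-- The Lebesgue density of the standard Gaussian measure. -/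
noncomputable def gaussianDensity (n : ℕ) (x : EuclideanSpace ℝ (Fin n)) : ℝ :=
  (2 * π) ^ (-(n : ℝ) / 2) * Real.exp (-‖x‖ ^ 2 / 2)

section

variable {n : ℕ}

local notation "E" => EuclideanSpace ℝ (Fin n)

lemma gaussianDensity_nonneg (x : E) : 0 ≤ gaussianDensity n x := by
  unfold gaussianDensity; positivity

lemma hasFDerivAt_gaussianDensity (x : E) :
    HasFDerivAt (gaussianDensity n) (-(gaussianDensity n x) • innerSL ℝ x) x := by
  have h := (((hasStrictFDerivAt_norm_sq x).hasFDerivAt.neg.mul_const (1 / 2)).exp).const_mul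
    ((2 * π) ^ (-(n : ℝ) / 2))
  refine (h.congr_fderiv ?_).congr_of_eventuallyEq (Eventually.of_forall fun y => ?_)
  · ext v
    simp [gaussianDensity, div_eq_mul_inv]
    ring
  · simp [gaussianDensity, div_eq_mul_inv]

lemma contDiff_gaussianDensity : ContDiff ℝ 1 (gaussianDensity n) := by
  unfold gaussianDensity
  exact contDiff_const.mul ((((contDiff_norm_sq ℝ).neg).div_const _).exp)

lemma gaussianMeasure_le :
    gaussianMeasure n ≤ ENNReal.ofReal ((2 * π) ^ (-(n : ℝ) / 2)) • (volume : Measure E) := by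
  rw [← withDensity_const]
  refine withDensity_mono (Eventually.of_forall fun x => ENNReal.ofReal_le_ofReal ?_)
  refine mul_le_of_le_one_right (by positivity) (Real.exp_le_one_iff.2 ?_)
  have := sq_nonneg ‖x‖
  linarith

lemma MeasureTheory.IntegrableOn.gaussianMeasure {f : E → ℝ} {s : Set E}
    (hf : IntegrableOn f s volume) : IntegrableOn f s (gaussianMeasure n) := by
  have h : IntegrableOn f s
      (ENNReal.ofReal ((2 * π) ^ (-(n : ℝ) / 2)) • (volume : Measure E)) := by
    rw [IntegrableOn, Measure.restrict_smul]
    exact Integrable.smul_measure hf ENNReal.ofReal_ne_top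
  exact h.mono_measure gaussianMeasure_le

lemma Continuous.integrableOn_ball_gaussianMeasure {f : E → ℝ} (hf : Continuous f)
    (x₀ : E) (r : ℝ) : IntegrableOn f (Metric.ball x₀ r) (gaussianMeasure n) :=
  ((hf.continuousOn.integrableOn_compact (isCompact_closedBall x₀ r)).mono_set
    Metric.ball_subset_closedBall).gaussianMeasure

lemma integral_gaussianMeasure (f : E → ℝ) :
    ∫ x, f x ∂(gaussianMeasure n) = ∫ x, gaussianDensity n x * f x := by
  rw [gaussianMeasure, integral_withDensity_eq_integral_toReal_smul]
  · refine integral_congr_ae (Eventually.of_forall fun x => ?_)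
    change (ENNReal.ofReal (gaussianDensity n x)).toReal • f x = _
    rw [ENNReal.toReal_ofReal (gaussianDensity_nonneg x), smul_eq_mul]
  · exact (contDiff_gaussianDensity (n := n)).continuous.measurable.ennreal_ofReal
  · simp

lemma continuous_gdiv {ψ : E → E} (hψ : ContDiff ℝ 1 ψ) : Continuous (gdiv n ψ) := by
  have h := hψ.continuous_fderiv (by norm_num)
  have h' := hψ.continuous
  unfold gdiv
  fun_prop

lemma gdiv_sub_smul {φ ψ : E → E} (hφ : ContDiff ℝ 1 φ) (hψ : ContDiff ℝ 1 ψ) (c : ℝ) (x : E) :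
    gdiv n (fun y => φ y - c • ψ y) x = gdiv n φ x - c * gdiv n ψ x := by
  have hφ' := hφ.differentiable (by norm_num) x
  have hψ' := hψ.differentiable (by norm_num) x
  simp only [gdiv]
  rw [fderiv_fun_sub hφ' (hψ'.fun_const_smul c), fderiv_fun_const_smul hψ']
  simp [inner_sub_right, inner_smul_right, Finset.sum_sub_distrib, Finset.mul_sum, mul_sub]
  ring

lemma gaussianDensity_mul_gdiv {ψ : E → E} (hψ : ContDiff ℝ 1 ψ) (x : E) :
    gaussianDensity n x * gdiv n ψ x =
      ∑ i, fderiv ℝ (fun y => gaussianDensity n y * ψ y i) x (EuclideanSpace.single i 1) := by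
  have hψ' := (hψ.differentiable (by norm_num) x).hasFDerivAt
  have hi (i : Fin n) := ((hasFDerivAt_gaussianDensity x).mul
    ((EuclideanSpace.proj (𝕜 := ℝ) i).hasFDerivAt.comp x hψ')).fderiv
  have (i : Fin n) : fderiv ℝ (fun y => gaussianDensity n y * ψ y i) x
      (EuclideanSpace.single i 1) = gaussianDensity n x * (fderiv ℝ ψ x
        (EuclideanSpace.single i 1) i) - gaussianDensity n x * (x i * ψ x i) := by
    refine (congrArg (fun L => L (EuclideanSpace.single i 1)) (hi i)).trans ?_
    simp [EuclideanSpace.inner_single_right]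
    ring
  simp_rw [this, Finset.sum_sub_distrib, ← Finset.mul_sum, gdiv, mul_sub, PiLp.inner_apply]
  simp [mul_comm]

/-- Integration by parts for the Gaussian divergence against a compactly supported function. -/
lemma integral_mul_gdiv {η : E → ℝ} (hη : ContDiff ℝ 1 η) (hc : HasCompactSupport η)
    {ψ : E → E} (hψ : ContDiff ℝ 1 ψ) :
    ∫ x, η x * gdiv n ψ x ∂(gaussianMeasure n) =
      -∫ x, gaussianDensity n x * fderiv ℝ η x (ψ x) := by
  have hg (i : Fin n) : ContDiff ℝ 1 (fun y => gaussianDensity n y * ψ y i) :=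
    contDiff_gaussianDensity.mul (by fun_prop)
  have hη' := hη.continuous_fderiv (by norm_num)
  have hg' (i : Fin n) := (hg i).continuous_fderiv (by norm_num)
  have hint (i : Fin n) : Integrable (fun x => η x *
      fderiv ℝ (fun y => gaussianDensity n y * ψ y i) x (EuclideanSpace.single i 1)) := by
    refine Continuous.integrable_of_hasCompactSupport ?_ hc.mul_right
    have := hg' i
    have := hη.continuous
    fun_prop
  have hint' (i : Fin n) : Integrable (fun x => fderiv ℝ η x (EuclideanSpace.single i 1) *
      (gaussianDensity n x * ψ x i)) := by
    refine Continuous.integrable_of_hasCompactSupport ?_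
      (hc.fderiv_apply ℝ (EuclideanSpace.single i 1)).mul_right
    have := (hg i).continuous
    fun_prop
  have hparts (i : Fin n) := integral_mul_fderiv_eq_neg_fderiv_mul_of_integrable
    (hint' i) (hint i)
    (Continuous.integrable_of_hasCompactSupport (hη.continuous.mul (hg i).continuous) hc.mul_right)
    (fun x _ => hη.differentiable (by norm_num) x)
    (fun x _ => (hg i).differentiable (by norm_num) x)
  calc ∫ x, η x * gdiv n ψ x ∂(gaussianMeasure n)
      = ∫ x, ∑ i, η x * fderiv ℝ (fun y => gaussianDensity n y * ψ y i) x
          (EuclideanSpace.single i 1) := by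
        rw [integral_gaussianMeasure]
        congr with x
        rw [← Finset.mul_sum, ← gaussianDensity_mul_gdiv hψ]
        ring
    _ = -∫ x, ∑ i, fderiv ℝ η x (EuclideanSpace.single i 1) * (gaussianDensity n x * ψ x i) := by
        rw [integral_finsetSum _ fun i _ => hint i, integral_finsetSum _ fun i _ => hint' i,
          ← Finset.sum_neg_distrib]
        exact Finset.sum_congr rfl fun i _ => hparts i
    _ = -∫ x, gaussianDensity n x * fderiv ℝ η x (ψ x) := by
        congr with x
        conv_rhs => rw [← (EuclideanSpace.basisFun (Fin n) ℝ).sum_repr (ψ x)]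
        simp [Finset.mul_sum]
        exact Finset.sum_congr rfl fun i _ => by ring

/-- A smooth radial cutoff function, increasing in `k` to the indicator function of the ball. -/
noncomputable def ballCutoff (x₀ : E) (r : ℝ) (k : ℕ) (x : E) : ℝ :=
  Real.smoothTransition (k * (r ^ 2 - ‖x - x₀‖ ^ 2))

lemma contDiff_ballCutoff (x₀ : E) (r : ℝ) (k : ℕ) : ContDiff ℝ 1 (ballCutoff x₀ r k) :=
  Real.smoothTransition.contDiff.comp <|
    contDiff_const.mul (contDiff_const.sub ((contDiff_id.sub contDiff_const).norm_sq ℝ))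

lemma ballCutoff_eq_zero {x₀ : E} {r : ℝ} (hr : 0 < r) (k : ℕ) {x : E}
    (hx : x ∉ Metric.ball x₀ r) : ballCutoff x₀ r k x = 0 := by
  rw [Metric.mem_ball, dist_eq_norm, not_lt] at hx
  refine Real.smoothTransition.zero_of_nonpos (mul_nonpos_of_nonneg_of_nonpos k.cast_nonneg ?_)
  have := pow_le_pow_left₀ hr.le hx 2
  linarith

lemma ballCutoff_nonneg (x₀ : E) (r : ℝ) (k : ℕ) (x : E) : 0 ≤ ballCutoff x₀ r k x :=
  Real.smoothTransition.nonneg _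

lemma ballCutoff_le_one (x₀ : E) (r : ℝ) (k : ℕ) (x : E) : ballCutoff x₀ r k x ≤ 1 :=
  Real.smoothTransition.le_one _

lemma hasCompactSupport_ballCutoff (x₀ : E) {r : ℝ} (hr : 0 < r) (k : ℕ) :
    HasCompactSupport (ballCutoff x₀ r k) := by
  refine HasCompactSupport.of_support_subset_isCompact (isCompact_closedBall x₀ r) fun x hx => ?_
  by_contra h
  exact hx (ballCutoff_eq_zero hr k fun h' => h (Metric.ball_subset_closedBall h'))

lemma tendsto_ballCutoff {x₀ : E} {r : ℝ} {x : E} (hx : x ∈ Metric.ball x₀ r) :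
    Tendsto (fun k => ballCutoff x₀ r k x) atTop (nhds 1) := by
  rw [Metric.mem_ball, dist_eq_norm] at hx
  have h : 0 < r ^ 2 - ‖x - x₀‖ ^ 2 := sub_pos.2 (pow_lt_pow_left₀ hx (norm_nonneg _) two_ne_zero)
  have ht : Tendsto (fun k : ℕ => (k : ℝ) * (r ^ 2 - ‖x - x₀‖ ^ 2)) atTop atTop :=
    tendsto_natCast_atTop_atTop.atTop_mul_const h
  refine tendsto_const_nhds.congr' ?_
  filter_upwards [ht.eventually_ge_atTop 1] with k hk
  exact (Real.smoothTransition.one_of_one_le hk).symm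

lemma fderiv_ballCutoff (x₀ : E) (r : ℝ) (k : ℕ) (x v : E) :
    fderiv ℝ (ballCutoff x₀ r k) x v =
      -(deriv Real.smoothTransition (k * (r ^ 2 - ‖x - x₀‖ ^ 2)) * (k * (2 * ⟪x - x₀, v⟫))) := by
  have h1 := ((((hasFDerivAt_id (𝕜 := ℝ) x).sub_const x₀).norm_sq.const_sub (r ^ 2)).const_mul
    (k : ℝ))
  have h2 := ((Real.smoothTransition.contDiff (n := 1)).differentiable (by norm_num)
    (k * (r ^ 2 - ‖x - x₀‖ ^ 2))).hasDerivAt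
  have h3 : HasFDerivAt (ballCutoff x₀ r k) _ x := h2.comp_hasFDerivAt x h1
  rw [h3.fderiv]
  simp [inner_sub_left]

lemma deriv_smoothTransition_of_one_lt {t : ℝ} (ht : 1 < t) :
    deriv Real.smoothTransition t = 0 := by
  have : Real.smoothTransition =ᶠ[nhds t] fun _ => 1 := by
    filter_upwards [lt_mem_nhds ht] with s hs
    exact Real.smoothTransition.one_of_one_le hs.le
  rw [this.deriv_eq, deriv_const]

/-- A field which points outwards near the boundary of a ball has nonnegative total Gaussian
divergence on the ball. -/
lemma integral_ball_gdiv_nonneg {x₀ : E} {r : ℝ} (hr : 0 < r) {ψ : E → E} (hψ : ContDiff ℝ 1 ψ)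
    (hpos : ∀ x, r / 2 ≤ ‖x - x₀‖ → 0 ≤ ⟪x - x₀, ψ x⟫) :
    0 ≤ ∫ x in Metric.ball x₀ r, gdiv n ψ x ∂(gaussianMeasure n) := by
  have hlim : Tendsto (fun k => ∫ x, ballCutoff x₀ r k x * gdiv n ψ x ∂(gaussianMeasure n)) atTop
      (nhds (∫ x in Metric.ball x₀ r, gdiv n ψ x ∂(gaussianMeasure n))) := by
    rw [← integral_indicator measurableSet_ball]
    refine tendsto_integral_of_dominated_convergence
      ((Metric.ball x₀ r).indicator fun x => ‖gdiv n ψ x‖) (fun k => ?_) ?_ (fun k => ?_) ?_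
    · exact ((contDiff_ballCutoff x₀ r k).continuous.mul
        (continuous_gdiv hψ)).aestronglyMeasurable
    · exact ((continuous_gdiv hψ).norm.integrableOn_ball_gaussianMeasure x₀ r).integrable_indicator
        measurableSet_ball
    · refine Eventually.of_forall fun x => ?_
      by_cases hx : x ∈ Metric.ball x₀ r
      · rw [Set.indicator_of_mem hx, norm_mul, Real.norm_of_nonneg (ballCutoff_nonneg x₀ r k x)]
        exact mul_le_of_le_one_left (norm_nonneg _) (ballCutoff_le_one x₀ r k x)
      · simp [hx, ballCutoff_eq_zero hr k hx]
    · refine Eventually.of_forall fun x => ?_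
      by_cases hx : x ∈ Metric.ball x₀ r
      · simpa [hx] using (tendsto_ballCutoff hx).mul_const (gdiv n ψ x)
      · simp [hx, ballCutoff_eq_zero hr _ hx]
  have hk : Tendsto (fun k : ℕ => (k : ℝ) * (r ^ 2 - (r / 2) ^ 2)) atTop atTop :=
    tendsto_natCast_atTop_atTop.atTop_mul_const (by nlinarith)
  refine ge_of_tendsto hlim ?_
  filter_upwards [hk.eventually_gt_atTop 1] with k hk
  rw [integral_mul_gdiv (contDiff_ballCutoff x₀ r k) (hasCompactSupport_ballCutoff x₀ hr k) hψ,
    ← integral_neg]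
  refine integral_nonneg fun x => ?_
  simp only [fderiv_ballCutoff, Pi.zero_apply, mul_neg, neg_neg]
  refine mul_nonneg (gaussianDensity_nonneg x) ?_
  rcases le_or_gt (r / 2) ‖x - x₀‖ with hx | hx
  · have h1 := Real.smoothTransition.monotone.deriv_nonneg (x := k * (r ^ 2 - ‖x - x₀‖ ^ 2))
    have h2 := hpos x hx
    positivity
  · have h1 := pow_lt_pow_left₀ hx (norm_nonneg _) two_ne_zero
    have h2 : (k : ℝ) * (r ^ 2 - (r / 2) ^ 2) ≤ k * (r ^ 2 - ‖x - x₀‖ ^ 2) := by gcongr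
    rw [deriv_smoothTransition_of_one_lt (hk.trans_le h2), zero_mul]

/-- A smooth admissible approximation of the exterior unit normal field `(x - x₀) / ‖x - x₀‖`. -/
noncomputable def smoothNormal (x₀ : E) (δ : ℝ) (x : E) : E :=
  (√(δ ^ 2 + ‖x - x₀‖ ^ 2))⁻¹ • (x - x₀)

lemma hasFDerivAt_smoothNormal (x₀ : E) {δ : ℝ} (hδ : 0 < δ) (x : E) :
    HasFDerivAt (smoothNormal x₀ δ)
      ((√(δ ^ 2 + ‖x - x₀‖ ^ 2))⁻¹ • ContinuousLinearMap.id ℝ E +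
        (-(√(δ ^ 2 + ‖x - x₀‖ ^ 2))⁻¹ ^ 3 • innerSL ℝ (x - x₀)).smulRight (x - x₀)) x := by
  have hs : 0 < δ ^ 2 + ‖x - x₀‖ ^ 2 := by positivity
  have hid := (hasFDerivAt_id (𝕜 := ℝ) x).sub_const x₀
  have h1 := (hid.norm_sq.const_add (δ ^ 2)).sqrt hs.ne'
  have h2 := (hasDerivAt_inv (Real.sqrt_pos.2 hs).ne').comp_hasFDerivAt x h1
  refine (h2.smul hid).congr_fderiv ?_
  ext v i
  have := (Real.sqrt_pos.2 hs).ne'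
  simp
  field_simp
  simp

lemma contDiff_smoothNormal (x₀ : E) {δ : ℝ} (hδ : 0 < δ) :
    ContDiff ℝ 1 (smoothNormal x₀ δ) := by
  have hs (x : E) : 0 < δ ^ 2 + ‖x - x₀‖ ^ 2 := by positivity
  have hid : ContDiff ℝ 1 fun x : E => x - x₀ := contDiff_id.sub contDiff_const
  exact (((contDiff_const.add (hid.norm_sq ℝ)).sqrt fun x => (hs x).ne').inv
    fun x => (Real.sqrt_pos.2 (hs x)).ne').smul hid

lemma le_sqrt_sq_add_sq (δ s : ℝ) : s ≤ √(δ ^ 2 + s ^ 2) :=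
  Real.le_sqrt_of_sq_le (by nlinarith)

lemma inv_sqrt_pow_three_mul_sq_le {δ : ℝ} (hδ : 0 < δ) (s : ℝ) :
    (√(δ ^ 2 + s ^ 2))⁻¹ ^ 3 * s ^ 2 ≤ (√(δ ^ 2 + s ^ 2))⁻¹ := by
  have h : 0 < √(δ ^ 2 + s ^ 2) := Real.sqrt_pos.2 (by positivity)
  have h' := Real.sq_sqrt (show 0 ≤ δ ^ 2 + s ^ 2 by positivity)
  rw [inv_pow, ← div_eq_inv_mul, div_le_iff₀ (by positivity)]
  field_simp
  nlinarith

lemma admissible_smoothNormal (x₀ : E) {δ : ℝ} (hδ : 0 < δ) :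
    Admissible n (smoothNormal x₀ δ) := by
  refine ⟨contDiff_smoothNormal x₀ hδ, ⟨2 * δ⁻¹, fun x => ?_⟩, fun x => ?_⟩
  · have hq : (√(δ ^ 2 + ‖x - x₀‖ ^ 2))⁻¹ ≤ δ⁻¹ :=
      inv_anti₀ hδ (Real.le_sqrt_of_sq_le (by nlinarith [norm_nonneg (x - x₀)]))
    rw [(hasFDerivAt_smoothNormal x₀ hδ x).fderiv]
    refine (norm_add_le _ _).trans ?_
    rw [ContinuousLinearMap.norm_smulRight_apply, norm_smul, norm_smul, innerSL_apply_norm,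
      norm_neg, norm_pow, Real.norm_of_nonneg (by positivity)]
    have h1 := inv_sqrt_pow_three_mul_sq_le hδ ‖x - x₀‖
    have h2 : (√(δ ^ 2 + ‖x - x₀‖ ^ 2))⁻¹ * ‖ContinuousLinearMap.id ℝ E‖ ≤
        (√(δ ^ 2 + ‖x - x₀‖ ^ 2))⁻¹ :=
      mul_le_of_le_one_right (by positivity) ContinuousLinearMap.norm_id_le
    nlinarith
  · have hs : 0 < √(δ ^ 2 + ‖x - x₀‖ ^ 2) := Real.sqrt_pos.2 (by positivity)
    rw [smoothNormal, norm_smul, Real.norm_of_nonneg (by positivity), inv_mul_le_iff₀ hs, mul_one]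
    exact le_sqrt_sq_add_sq δ _

lemma gdiv_smoothNormal (x₀ : E) {δ : ℝ} (hδ : 0 < δ) (x : E) :
    gdiv n (smoothNormal x₀ δ) x = n * (√(δ ^ 2 + ‖x - x₀‖ ^ 2))⁻¹ -
      (√(δ ^ 2 + ‖x - x₀‖ ^ 2))⁻¹ ^ 3 * ‖x - x₀‖ ^ 2 -
      (√(δ ^ 2 + ‖x - x₀‖ ^ 2))⁻¹ * ⟪x, x - x₀⟫ := by
  rw [gdiv, (hasFDerivAt_smoothNormal x₀ hδ x).fderiv, smoothNormal, inner_smul_right,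
    EuclideanSpace.real_norm_sq_eq (x - x₀), Finset.mul_sum]
  simp [EuclideanSpace.inner_single_right, Finset.sum_add_distrib]
  rw [← sub_eq_add_neg]
  congr 1
  exact Finset.sum_congr rfl fun i _ => by ring

lemma tendsto_gdiv_smoothNormal {x₀ x : E} (hx : x ≠ x₀) :
    Tendsto (fun δ => gdiv n (smoothNormal x₀ δ) x) (nhdsWithin 0 (Set.Ioi 0))
      (nhds (((n : ℝ) - 1) / ‖x - x₀‖ - ⟪x, x - x₀⟫ / ‖x - x₀‖)) := by
  have hs : 0 < ‖x - x₀‖ := norm_pos_iff.2 (sub_ne_zero.2 hx)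
  have hq : Tendsto (fun δ : ℝ => (√(δ ^ 2 + ‖x - x₀‖ ^ 2))⁻¹) (nhdsWithin 0 (Set.Ioi 0))
      (nhds ‖x - x₀‖⁻¹) := by
    have : ContinuousAt (fun δ : ℝ => (√(δ ^ 2 + ‖x - x₀‖ ^ 2))⁻¹) 0 :=
      ContinuousAt.inv₀ (by fun_prop) (by simp [hs.ne'])
    simpa using this.tendsto.mono_left nhdsWithin_le_nhds
  have h := ((hq.const_mul (n : ℝ)).sub ((hq.pow 3).mul_const (‖x - x₀‖ ^ 2))).sub
    (hq.mul_const ⟪x, x - x₀⟫)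
  refine (h.congr' ?_).trans_eq ?_
  · filter_upwards [self_mem_nhdsWithin] with δ hδ
    exact (gdiv_smoothNormal x₀ hδ x).symm
  · congr 1
    field_simp

lemma norm_gdiv_smoothNormal_le (x₀ : E) {δ : ℝ} (hδ : 0 < δ) {x : E} (hx : x ≠ x₀) :
    ‖gdiv n (smoothNormal x₀ δ) x‖ ≤ (n + 1) * ‖x - x₀‖⁻¹ + ‖x‖ := by
  have hs : 0 < ‖x - x₀‖ := norm_pos_iff.2 (sub_ne_zero.2 hx)
  have hq : (√(δ ^ 2 + ‖x - x₀‖ ^ 2))⁻¹ ≤ ‖x - x₀‖⁻¹ :=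
    inv_anti₀ hs (le_sqrt_sq_add_sq δ _)
  have h1 := inv_sqrt_pow_three_mul_sq_le hδ ‖x - x₀‖
  have h2 : |(√(δ ^ 2 + ‖x - x₀‖ ^ 2))⁻¹ * ⟪x, x - x₀⟫| ≤ ‖x‖ := by
    rw [abs_mul, abs_of_nonneg (by positivity)]
    calc _ ≤ ‖x - x₀‖⁻¹ * (‖x‖ * ‖x - x₀‖) := by
          gcongr
          exact abs_real_inner_le_norm _ _
      _ = ‖x‖ := by field_simp
  have h3 : (n : ℝ) * (√(δ ^ 2 + ‖x - x₀‖ ^ 2))⁻¹ ≤ n * ‖x - x₀‖⁻¹ := by gcongr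
  have h4 : 0 ≤ (√(δ ^ 2 + ‖x - x₀‖ ^ 2))⁻¹ ^ 3 * ‖x - x₀‖ ^ 2 := by positivity
  have h5 : 0 ≤ (n : ℝ) * (√(δ ^ 2 + ‖x - x₀‖ ^ 2))⁻¹ := by positivity
  have h6 : 0 ≤ ‖x - x₀‖⁻¹ := by positivity
  have h7 : 0 ≤ (n : ℝ) * ‖x - x₀‖⁻¹ := by positivity
  rw [gdiv_smoothNormal x₀ hδ, Real.norm_eq_abs, abs_le]
  rw [abs_le] at h2
  constructor <;> linarith

lemma integrableOn_ball_norm_sub_inv (hn : 2 ≤ n) (x₀ : E) (r : ℝ) :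
    IntegrableOn (fun x : E => ‖x - x₀‖⁻¹) (Metric.ball x₀ r) volume := by
  have : Nontrivial E := Module.nontrivial_of_finrank_pos (R := ℝ) (by simp; omega)
  have h0 : IntegrableOn (fun x : E => ‖x‖⁻¹) (Metric.ball 0 r) volume := by
    refine (integrableOn_fun_norm_addHaar (μ := volume) (f := fun y : ℝ => y⁻¹)).2 ?_
    have hc : IntegrableOn (fun y : ℝ => y ^ (n - 2)) (Set.Ioo 0 r) volume :=
      ((continuous_pow _).integrableOn_Icc).mono_set Set.Ioo_subset_Icc_self
    refine hc.congr_fun (fun y hy => ?_) measurableSet_Ioo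
    obtain ⟨m, rfl⟩ := Nat.exists_eq_add_of_le' hn
    have := hy.1.ne'
    simp [pow_succ]
    field_simp
  have h := (measurePreserving_sub_right (volume : Measure E) x₀).integrableOn_comp_preimage
    (Homeomorph.subRight x₀).measurableEmbedding (f := fun x : E => ‖x‖⁻¹)
    (s := Metric.ball 0 r)
  have hball : (fun x => x - x₀) ⁻¹' Metric.ball 0 r = Metric.ball x₀ r := by
    ext x
    simp [dist_eq_norm]
  rw [hball] at h
  exact h.2 h0

lemma tendsto_integral_gdiv_smoothNormal (hn : 2 ≤ n) (x₀ : E) (r : ℝ) :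
    IntegrableOn (fun x : E => ((n : ℝ) - 1) / ‖x - x₀‖ - ⟪x, x - x₀⟫ / ‖x - x₀‖)
      (Metric.ball x₀ r) (gaussianMeasure n) ∧
    Tendsto (fun δ => ∫ x in Metric.ball x₀ r, gdiv n (smoothNormal x₀ δ) x ∂(gaussianMeasure n))
      (nhdsWithin 0 (Set.Ioi 0)) (nhds (∫ x in Metric.ball x₀ r,
        (((n : ℝ) - 1) / ‖x - x₀‖ - ⟪x, x - x₀⟫ / ‖x - x₀‖) ∂(gaussianMeasure n))) := by
  have hbound : IntegrableOn (fun x : E => ((n : ℝ) + 1) * ‖x - x₀‖⁻¹ + ‖x‖)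
      (Metric.ball x₀ r) (gaussianMeasure n) :=
    ((integrableOn_ball_norm_sub_inv hn x₀ r).gaussianMeasure.const_mul _).add
      (continuous_norm.integrableOn_ball_gaussianMeasure x₀ r)
  have : Nontrivial E := Module.nontrivial_of_finrank_pos (R := ℝ) (by simp; omega)
  have hne : ∀ᵐ x ∂((gaussianMeasure n).restrict (Metric.ball x₀ r)), x ≠ x₀ := by
    refine ae_restrict_of_ae ((withDensity_absolutelyContinuous _ _).ae_le ?_)
    exact Measure.ae_ne volume x₀
  have hlim : ∀ᵐ x ∂((gaussianMeasure n).restrict (Metric.ball x₀ r)),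
      Tendsto (fun δ => gdiv n (smoothNormal x₀ δ) x) (nhdsWithin 0 (Set.Ioi 0))
        (nhds (((n : ℝ) - 1) / ‖x - x₀‖ - ⟪x, x - x₀⟫ / ‖x - x₀‖)) := by
    filter_upwards [hne] with x hx using tendsto_gdiv_smoothNormal hx
  have hle : ∀ᶠ δ in nhdsWithin (0 : ℝ) (Set.Ioi 0),
      ∀ᵐ x ∂((gaussianMeasure n).restrict (Metric.ball x₀ r)),
        ‖gdiv n (smoothNormal x₀ δ) x‖ ≤ (n + 1) * ‖x - x₀‖⁻¹ + ‖x‖ := by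
    filter_upwards [self_mem_nhdsWithin] with δ hδ
    filter_upwards [hne] with x hx using norm_gdiv_smoothNormal_le x₀ hδ hx
  have hmeas : ∀ᶠ δ in nhdsWithin (0 : ℝ) (Set.Ioi 0), AEStronglyMeasurable
      (gdiv n (smoothNormal x₀ δ)) ((gaussianMeasure n).restrict (Metric.ball x₀ r)) := by
    filter_upwards [self_mem_nhdsWithin] with δ hδ
    exact (continuous_gdiv (contDiff_smoothNormal x₀ hδ)).aestronglyMeasurable
  refine ⟨hbound.mono' ?_ ?_, tendsto_integral_filter_of_dominated_convergence _ hmeas hle hbound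
    hlim⟩
  · have h : Measurable fun x : E =>
        ((n : ℝ) - 1) / ‖x - x₀‖ - ⟪x, x - x₀⟫ / ‖x - x₀‖ := by fun_prop
    exact h.aestronglyMeasurable
  · filter_upwards [hne] with x hx
    refine le_of_tendsto (tendsto_gdiv_smoothNormal hx).norm ?_
    filter_upwards [self_mem_nhdsWithin] with δ hδ using norm_gdiv_smoothNormal_le x₀ hδ hx

/-- Near the sphere, `smoothNormal` dominates any field of norm at most `1`, up to a factor. -/
lemma inner_smoothNormal_sub_nonneg {x₀ : E} {r δ : ℝ} (hr : 0 < r) {φ : E → E}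
    (hφ : ∀ x, ‖φ x‖ ≤ 1) {x : E} (hx : r / 2 ≤ ‖x - x₀‖) :
    0 ≤ ⟪x - x₀, smoothNormal x₀ δ x - (r / 2 / √(δ ^ 2 + (r / 2) ^ 2)) • φ x⟫ := by
  set s := ‖x - x₀‖
  have hs : 0 < s := (half_pos hr).trans_le hx
  have h1 : ⟪x - x₀, φ x⟫ ≤ s :=
    (real_inner_le_norm _ _).trans (mul_le_of_le_one_right hs.le (hφ x))
  have h2 : r / 2 / √(δ ^ 2 + (r / 2) ^ 2) ≤ s / √(δ ^ 2 + s ^ 2) := by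
    rw [div_le_div_iff₀ (by positivity) (by positivity)]
    refine le_of_sq_le_sq ?_ (by positivity)
    rw [mul_pow, mul_pow, Real.sq_sqrt (by positivity), Real.sq_sqrt (by positivity)]
    nlinarith [pow_le_pow_left₀ (half_pos hr).le hx 2, sq_nonneg δ]
  rw [smoothNormal, inner_sub_right, inner_smul_right, inner_smul_right,
    real_inner_self_eq_norm_sq, sub_nonneg]
  calc r / 2 / √(δ ^ 2 + (r / 2) ^ 2) * ⟪x - x₀, φ x⟫
      ≤ r / 2 / √(δ ^ 2 + (r / 2) ^ 2) * s := by gcongr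
    _ ≤ s / √(δ ^ 2 + s ^ 2) * s := by gcongr
    _ = (√(δ ^ 2 + s ^ 2))⁻¹ * s ^ 2 := by ring

lemma integral_ball_gdiv_le (hn : 2 ≤ n) (x₀ : E) {r : ℝ} (hr : 0 < r) {φ : E → E}
    (hφ : Admissible n φ) :
    ∫ x in Metric.ball x₀ r, gdiv n φ x ∂(gaussianMeasure n) ≤ ∫ x in Metric.ball x₀ r,
      (((n : ℝ) - 1) / ‖x - x₀‖ - ⟪x, x - x₀⟫ / ‖x - x₀‖) ∂(gaussianMeasure n) := by
  have hκ : Tendsto (fun δ : ℝ => r / 2 / √(δ ^ 2 + (r / 2) ^ 2)) (nhdsWithin 0 (Set.Ioi 0))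
      (nhds 1) := by
    have h : ContinuousAt (fun δ : ℝ => r / 2 / √(δ ^ 2 + (r / 2) ^ 2)) 0 :=
      ContinuousAt.div₀ (by fun_prop) (by fun_prop) (by positivity)
    have h0 : r / 2 / √(0 ^ 2 + (r / 2) ^ 2) = 1 := by
      rw [zero_pow two_ne_zero, zero_add, Real.sqrt_sq (by positivity), div_self (by positivity)]
    simpa only [ContinuousAt, h0] using h.tendsto.mono_left nhdsWithin_le_nhds
  have h := hκ.mul_const (∫ x in Metric.ball x₀ r, gdiv n φ x ∂(gaussianMeasure n))
  rw [one_mul] at h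
  refine le_of_tendsto_of_tendsto h (tendsto_integral_gdiv_smoothNormal hn x₀ r).2 ?_
  filter_upwards [self_mem_nhdsWithin] with δ hδ
  have hN := contDiff_smoothNormal x₀ (Set.mem_Ioi.1 hδ)
  have hnn := integral_ball_gdiv_nonneg hr
    (hN.sub (hφ.1.const_smul (r / 2 / √(δ ^ 2 + (r / 2) ^ 2))))
    fun x hx => inner_smoothNormal_sub_nonneg (δ := δ) hr hφ.2.2 hx
  have heq : ∫ x in Metric.ball x₀ r, gdiv n
        (fun y => smoothNormal x₀ δ y - (r / 2 / √(δ ^ 2 + (r / 2) ^ 2)) • φ y) x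
        ∂(gaussianMeasure n) =
      ∫ x in Metric.ball x₀ r, gdiv n (smoothNormal x₀ δ) x ∂(gaussianMeasure n) -
        r / 2 / √(δ ^ 2 + (r / 2) ^ 2) *
          ∫ x in Metric.ball x₀ r, gdiv n φ x ∂(gaussianMeasure n) := by
    simp_rw [gdiv_sub_smul hN hφ.1]
    rw [integral_sub ((continuous_gdiv hN).integrableOn_ball_gaussianMeasure x₀ r)
      (((continuous_gdiv hφ.1).integrableOn_ball_gaussianMeasure x₀ r).const_mul _),
      integral_const_mul]
  exact sub_nonneg.1 (hnn.trans_eq heq)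

lemma integral_indicator_mul_gdiv (x₀ : E) (r : ℝ) (φ : E → E) :
    ∫ x, (Metric.ball x₀ r).indicator (fun _ => 1) x * gdiv n φ x ∂(gaussianMeasure n) =
      ∫ x in Metric.ball x₀ r, gdiv n φ x ∂(gaussianMeasure n) := by
  rw [← integral_indicator measurableSet_ball]
  congr with x
  by_cases hx : x ∈ Metric.ball x₀ r <;> simp [hx]

end

/-- For `n ≥ 2`, `x₀ ∈ ℝ^n` and `r > 0`, the Gaussian divergence of the
exterior unit normal field, `x ↦ (n−1)/‖x−x₀‖ − ⟨x, x−x₀⟩/‖x−x₀‖`, is `γ_n`-integrable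
on the open ball `B_r(x₀)` and
`P_γ(B_r(x₀)) = ∫_{B_r(x₀)} [(n−1)/‖x−x₀‖ − ⟨x, x−x₀⟩/‖x−x₀‖] dγ_n`; in particular every
ball has finite Gaussian perimeter. -/
theorem perimeter_of_ball (n : ℕ) (hn : 2 ≤ n)
    (x₀ : EuclideanSpace ℝ (Fin n)) (r : ℝ) (hr : 0 < r) :
    IntegrableOn (fun x => ((n : ℝ) - 1) / ‖x - x₀‖ - ⟪x, x - x₀⟫ / ‖x - x₀‖)
      (Metric.ball x₀ r) (gaussianMeasure n) ∧
    gPerimeter n (Metric.ball x₀ r) =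
      ENNReal.ofReal (∫ x in Metric.ball x₀ r,
        (((n : ℝ) - 1) / ‖x - x₀‖ - ⟪x, x - x₀⟫ / ‖x - x₀‖) ∂(gaussianMeasure n)) := by
  obtain ⟨hint, hlim⟩ := tendsto_integral_gdiv_smoothNormal hn x₀ r
  refine ⟨hint, le_antisymm (iSup₂_le fun φ hφ => ?_) ?_⟩
  · rw [integral_indicator_mul_gdiv]
    exact ENNReal.ofReal_le_ofReal (integral_ball_gdiv_le hn x₀ hr hφ)
  · refine le_of_tendsto (ENNReal.tendsto_ofReal hlim) ?_
    filter_upwards [self_mem_nhdsWithin] with δ hδ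
    rw [← integral_indicator_mul_gdiv]
    exact le_iSup₂_of_le (smoothNormal x₀ δ) (admissible_smoothNormal x₀ hδ) le_rfl
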